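/- (Proposition 3) In the copula-update process with learning rates α_{n+k} = C·(n+k+1)^{−β} for C > 0 and β ∈ (1/2, 1], let P_∞(y) denote the almost-sure limit of P_M(y) as M → ∞. Then for every fixed y ∈ ℝ, every integer N ≥ 0, and every δ ∈ (0,1), with probability at least 1 − δ, |P_∞(y) − P_N(y)| ≤ √(C²·log(2/δ)/(2β − 1)) · (n + N)^{1/2 − β}. -/

import Mathlib

open MeasureTheory ProbabilityTheory Filter Topology

/-- The standard normal cumulative distribution function `Φ`. -/
noncomputable def Phi (t : ℝ) : ℝ := ((gaussianReal 0 1) (Set.Iic t)).toReal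

/-- The inverse (quantile function) of the standard normal CDF. -/
noncomputable def PhiInv (u : ℝ) : ℝ := sInf {x : ℝ | u ≤ Phi x}

/-- The Gaussian copula update function `H_ρ(u,v)`, extended by `H_ρ(0,v) = 0` and
`H_ρ(1,v) = 1`. -/
noncomputable def Hcop (ρ u v : ℝ) : ℝ :=
  if u = 0 then 0
  else if u = 1 then 1
  else Phi ((PhiInv u - ρ * PhiInv v) / Real.sqrt (1 - ρ ^ 2))

/-- The copula-update process of the martingale posterior construction: an initial random
CDF `P₀`, samples `y_{n+k}` whose conditional probability integral transform
`P_{k−1}(y_{n+k})` is uniform on `[0,1]` given `𝓕_{k−1}`, and the recursive Gaussian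
copula update `P_k(y) = (1 − α_{n+k})·P_{k−1}(y) + α_{n+k}·H_ρ(P_{k−1}(y), P_{k−1}(y_{n+k}))`.
Here `Pk k ω` is the random function `P_k` and `y k` is the random variable `y_{n+k}`. -/
structure CopulaProcess (Ω : Type*) [mΩ : MeasurableSpace Ω] (P : Measure Ω) where
  /-- the copula parameter `ρ ∈ (−1,1)` -/
  ρ : ℝ
  hρ : ρ ∈ Set.Ioo (-1 : ℝ) 1
  /-- the number `n` of originally observed data points -/
  n : ℕ
  hn : 1 ≤ n
  /-- the learning rates: `α (n+k)` is the rate `α_{n+k}` used in step `k` -/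
  α : ℕ → ℝ
  hα : ∀ k, 1 ≤ k → α (n + k) ∈ Set.Ioo (0 : ℝ) 1
  /-- the filtration `(𝓕_k)_{k ≥ 0}` -/
  ℱ : Filtration ℕ mΩ
  /-- `Pk k ω` is the random distribution function `P_k` -/
  Pk : ℕ → Ω → ℝ → ℝ
  /-- `y k` is the random variable `y_{n+k}` (for `k ≥ 1`) -/
  y : ℕ → Ω → ℝ
  /-- `P₀(t)` is `𝓕₀`-measurable for every `t` -/
  meas0 : ∀ t : ℝ, StronglyMeasurable[ℱ 0] fun ω => Pk 0 ω t
  /-- `P₀` is continuous -/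
  cont0 : ∀ ω, Continuous (Pk 0 ω)
  /-- `P₀` is strictly increasing -/
  strictMono0 : ∀ ω, StrictMono (Pk 0 ω)
  /-- `P₀` takes values in `(0,1)` (it is strictly increasing onto `(0,1)`) -/
  mem0 : ∀ ω t, Pk 0 ω t ∈ Set.Ioo (0 : ℝ) 1
  /-- `P₀` has limit `0` at `−∞` -/
  tendsto_atBot0 : ∀ ω, Tendsto (Pk 0 ω) atBot (𝓝 0)
  /-- `P₀` has limit `1` at `+∞` -/
  tendsto_atTop0 : ∀ ω, Tendsto (Pk 0 ω) atTop (𝓝 1)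
  /-- `y_{n+k}` is `𝓕_k`-measurable -/
  measy : ∀ k, 1 ≤ k → StronglyMeasurable[ℱ k] (y k)
  /-- conditionally on `𝓕_{k−1}`, the random variable `P_{k−1}(y_{n+k})` is uniformly
  distributed on `[0,1]` -/
  unif : ∀ k, 1 ≤ k → ∀ A : Set Ω, MeasurableSet[ℱ (k - 1)] A →
    ∀ u ∈ Set.Icc (0 : ℝ) 1,
      P (A ∩ {ω | Pk (k - 1) ω (y k ω) ≤ u}) = P A * ENNReal.ofReal u
  /-- the recursive Gaussian copula update defining `P_k` from `P_{k−1}` -/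
  step : ∀ k, 1 ≤ k → ∀ ω t,
    Pk k ω t = (1 - α (n + k)) * Pk (k - 1) ω t
      + α (n + k) * Hcop ρ (Pk (k - 1) ω t) (Pk (k - 1) ω (y k ω))

theorem Phi_eq_setIntegral (t : ℝ) : Phi t = ∫ x in Set.Iic t, gaussianPDFReal 0 1 x := by
  rw [Phi, gaussianReal_apply_eq_integral 0 one_ne_zero, ENNReal.toReal_ofReal]
  exact integral_nonneg fun x => gaussianPDFReal_nonneg 0 1 x

theorem Phi_sub_Phi (s t : ℝ) : Phi t - Phi s = ∫ x in s..t, gaussianPDFReal 0 1 x := by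
  rw [Phi_eq_setIntegral, Phi_eq_setIntegral]
  exact intervalIntegral.integral_Iic_sub_Iic (integrable_gaussianPDFReal 0 1).integrableOn
    (integrable_gaussianPDFReal 0 1).integrableOn

theorem continuous_Phi : Continuous Phi := by
  have h : Phi = fun t => Phi 0 + ∫ x in (0 : ℝ)..t, gaussianPDFReal 0 1 x := by
    ext t
    rw [← Phi_sub_Phi]
    ring
  rw [h]
  exact continuous_const.add (intervalIntegral.continuous_primitive
    (fun a b => (integrable_gaussianPDFReal 0 1).intervalIntegrable) 0)

theorem strictMono_Phi : StrictMono Phi := by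
  intro s t hst
  rw [← sub_pos, Phi_sub_Phi]
  exact intervalIntegral.intervalIntegral_pos_of_pos
    (integrable_gaussianPDFReal 0 1).intervalIntegrable
    (fun x => gaussianPDFReal_pos 0 1 x one_ne_zero) hst

theorem Phi_eq_cdf : Phi = cdf (gaussianReal 0 1) := by
  ext t
  rw [cdf_eq_real]
  rfl

theorem tendsto_Phi_atBot : Tendsto Phi atBot (𝓝 0) :=
  Phi_eq_cdf ▸ tendsto_cdf_atBot _

theorem tendsto_Phi_atTop : Tendsto Phi atTop (𝓝 1) :=
  Phi_eq_cdf ▸ tendsto_cdf_atTop _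

theorem Phi_mem_Ioo (t : ℝ) : Phi t ∈ Set.Ioo (0 : ℝ) 1 := by
  have h0 : ∀ s, 0 ≤ Phi s := fun s => Phi_eq_cdf ▸ cdf_nonneg _ s
  have h1 : ∀ s, Phi s ≤ 1 := fun s => Phi_eq_cdf ▸ cdf_le_one _ s
  exact ⟨(h0 (t - 1)).trans_lt (strictMono_Phi (by linarith)),
    (strictMono_Phi (by linarith : t < t + 1)).trans_le (h1 _)⟩

theorem exists_Phi_eq {u : ℝ} (hu : u ∈ Set.Ioo (0 : ℝ) 1) : ∃ z, Phi z = u := by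
  obtain ⟨a, ha⟩ := (tendsto_Phi_atBot.eventually (gt_mem_nhds hu.1)).exists
  obtain ⟨b, hb⟩ := (tendsto_Phi_atTop.eventually (lt_mem_nhds hu.2)).exists
  exact mem_range_of_exists_le_of_exists_ge continuous_Phi ⟨a, ha.le⟩ ⟨b, hb.le⟩

theorem PhiInv_Phi (z : ℝ) : PhiInv (Phi z) = z := by
  have : {x : ℝ | Phi z ≤ Phi x} = Set.Ici z := by
    ext x
    simp [strictMono_Phi.le_iff_le]
  rw [PhiInv, this, csInf_Ici]

theorem PhiInv_eq_extend : PhiInv = Function.extend Phi id 0 := by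
  ext u
  by_cases hu : ∃ z, Phi z = u
  · obtain ⟨z, rfl⟩ := hu
    rw [PhiInv_Phi, strictMono_Phi.injective.extend_apply, id]
  · rw [Function.extend_apply' _ _ _ hu, PhiInv]
    rcases le_or_gt u 0 with h | h
    · have : {x : ℝ | u ≤ Phi x} = Set.univ :=
        Set.eq_univ_of_forall fun x => h.trans (Phi_mem_Ioo x).1.le
      simp [this]
    · have h1 : 1 ≤ u := not_lt.1 fun h1 => hu (exists_Phi_eq ⟨h, h1⟩)
      have : {x : ℝ | u ≤ Phi x} = ∅ :=
        Set.eq_empty_of_forall_notMem fun x hx => (Phi_mem_Ioo x).2.not_ge (h1.trans hx)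
      simp [this]

theorem measurable_PhiInv : Measurable PhiInv := by
  rw [PhiInv_eq_extend]
  exact (continuous_Phi.measurableEmbedding strictMono_Phi.injective).measurable_extend
    measurable_id measurable_const

theorem measurable_Hcop (ρ : ℝ) : Measurable fun p : ℝ × ℝ => Hcop ρ p.1 p.2 := by
  refine Measurable.ite (measurable_fst (measurableSet_singleton 0)) measurable_const
    (Measurable.ite (measurable_fst (measurableSet_singleton 1)) measurable_const ?_)
  exact continuous_Phi.measurable.comp (((measurable_PhiInv.comp measurable_fst).sub
    ((measurable_PhiInv.comp measurable_snd).const_mul ρ)).div_const _)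

theorem Hcop_mem_Icc (ρ u v : ℝ) : Hcop ρ u v ∈ Set.Icc (0 : ℝ) 1 := by
  unfold Hcop
  split_ifs
  · simp
  · simp
  · exact Set.Ioo_subset_Icc_self (Phi_mem_Ioo _)

/-- If `V` is uniform on `[0,1]` given the event `A`, then its law restricted to `A` is the
rescaled law of `Φ(Z)` for a standard normal `Z`. -/
theorem map_restrict_eq_smul_map_Phi {Ω : Type*} [MeasurableSpace Ω] (P : Measure Ω)
    [IsFiniteMeasure P] {V : Ω → ℝ} (hV : Measurable V) (hV01 : ∀ ω, V ω ∈ Set.Ioo (0 : ℝ) 1)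
    {A : Set Ω}
    (hunif : ∀ u ∈ Set.Icc (0 : ℝ) 1, P (A ∩ {ω | V ω ≤ u}) = P A * ENNReal.ofReal u) :
    (P.restrict A).map V = P A • (gaussianReal 0 1).map Phi := by
  refine Measure.ext_of_Iic _ _ fun a => ?_
  rw [Measure.map_apply hV measurableSet_Iic, Measure.restrict_apply (hV measurableSet_Iic),
    Measure.smul_apply, Measure.map_apply continuous_Phi.measurable measurableSet_Iic, smul_eq_mul]
  rcases le_or_gt a 0 with h0 | h0
  · have h1 : V ⁻¹' Set.Iic a = ∅ :=
      Set.eq_empty_of_forall_notMem fun ω hω => (hV01 ω).1.not_ge (le_trans hω h0)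
    have h2 : Phi ⁻¹' Set.Iic a = ∅ :=
      Set.eq_empty_of_forall_notMem fun ω hω => (Phi_mem_Ioo ω).1.not_ge (le_trans hω h0)
    simp [h1, h2]
  rcases le_or_gt 1 a with h1 | h1
  · have h2 : V ⁻¹' Set.Iic a = Set.univ :=
      Set.eq_univ_of_forall fun ω => (hV01 ω).2.le.trans h1
    have h3 : Phi ⁻¹' Set.Iic a = Set.univ :=
      Set.eq_univ_of_forall fun ω => (Phi_mem_Ioo ω).2.le.trans h1
    simp [h2, h3]
  obtain ⟨z, rfl⟩ := exists_Phi_eq ⟨h0, h1⟩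
  have h2 : Phi ⁻¹' Set.Iic (Phi z) = Set.Iic z := by
    ext x
    simp [strictMono_Phi.le_iff_le]
  have h3 := hunif (Phi z) ⟨h0.le, h1.le⟩
  rw [Set.inter_comm] at h3
  rw [h2]
  refine h3.trans ?_
  rw [Phi, ENNReal.ofReal_toReal (measure_ne_top _ _)]

/-- `u ↦ ∫ H_ρ(u,v) dv` is the identity: the copula update is a martingale step. -/
theorem integral_Hcop {ρ u : ℝ} (hρ : ρ ∈ Set.Ioo (-1 : ℝ) 1) (hu : u ∈ Set.Ioo (0 : ℝ) 1) :
    ∫ v, Hcop ρ u v ∂((gaussianReal 0 1).map Phi) = u := by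
  obtain ⟨a, rfl⟩ := exists_Phi_eq hu
  have hσ2 : 0 < 1 - ρ ^ 2 := by nlinarith [hρ.1, hρ.2]
  set σ := Real.sqrt (1 - ρ ^ 2) with hσdef
  have hσ : 0 < σ := Real.sqrt_pos.2 hσ2
  have hσsq : σ ^ 2 = 1 - ρ ^ 2 := Real.sq_sqrt hσ2.le
  have hm : Measurable fun v => Hcop ρ (Phi a) v :=
    (measurable_Hcop ρ).comp measurable_prodMk_left
  rw [integral_map continuous_Phi.measurable.aemeasurable hm.aestronglyMeasurable]
  have hH : ∀ z, Hcop ρ (Phi a) (Phi z) = Phi ((a - ρ * z) / σ) := fun z => by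
    rw [Hcop, if_neg hu.1.ne', if_neg hu.2.ne, PhiInv_Phi, PhiInv_Phi]
  simp_rw [hH]
  have hconv : ((gaussianReal 0 1).map (ρ * ·)).conv ((gaussianReal 0 1).map (σ * ·))
      = gaussianReal 0 1 := by
    rw [gaussianReal_map_const_mul, gaussianReal_map_const_mul, gaussianReal_conv_gaussianReal]
    congr 1
    · simp
    · ext
      simp [hσsq]
  have key : gaussianReal 0 1 (Set.Iic a)
      = ∫⁻ z, gaussianReal 0 1 (Set.Iic ((a - ρ * z) / σ)) ∂(gaussianReal 0 1) := by
    conv_lhs => rw [← hconv]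
    have : Measurable fun p : ℝ × ℝ => p.1 + p.2 := measurable_add
    rw [Measure.conv, Measure.map_prod_map _ _ (by fun_prop) (by fun_prop),
      Measure.map_map this (by fun_prop), Measure.map_apply (by fun_prop) measurableSet_Iic,
      Measure.prod_apply (by measurability)]
    refine lintegral_congr fun z => ?_
    congr 1
    ext w
    simp only [Set.mem_preimage, Function.comp_apply, Prod.map_apply, Set.mem_Iic]
    rw [le_div_iff₀ hσ]
    constructor <;> intro h <;> linarith
  rw [integral_eq_lintegral_of_nonneg_ae (ae_of_all _ fun z => (Phi_mem_Ioo _).1.le)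
    (continuous_Phi.comp (by fun_prop)).aestronglyMeasurable, Phi, key]
  congr 1
  refine lintegral_congr fun z => ?_
  rw [Phi, ENNReal.ofReal_toReal (measure_ne_top _ _)]

theorem lintegral_exp_Hcop_sub_le {ρ u : ℝ} (hρ : ρ ∈ Set.Ioo (-1 : ℝ) 1)
    (hu : u ∈ Set.Ioo (0 : ℝ) 1) (c : ℝ) :
    ∫⁻ v, ENNReal.ofReal (Real.exp (c * (Hcop ρ u v - u))) ∂((gaussianReal 0 1).map Phi)
      ≤ ENNReal.ofReal (Real.exp (c ^ 2 / 8)) := by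
  have : IsProbabilityMeasure ((gaussianReal 0 1).map Phi) :=
    Measure.isProbabilityMeasure_map continuous_Phi.measurable.aemeasurable
  have hm : Measurable fun v => Hcop ρ u v := (measurable_Hcop ρ).comp measurable_prodMk_left
  have h := hasSubgaussianMGF_of_mem_Icc (μ := (gaussianReal 0 1).map Phi) hm.aemeasurable
    (ae_of_all _ fun v => Hcop_mem_Icc ρ u v)
  rw [integral_Hcop hρ hu] at h
  rw [← ofReal_integral_eq_lintegral_ofReal (h.integrable_exp_mul c)
    (ae_of_all _ fun v => (Real.exp_pos _).le)]
  refine ENNReal.ofReal_le_ofReal ((h.mgf_le c).trans_eq ?_)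
  congr 1
  simp
  ring

/-- One step of the Azuma-Hoeffding argument: conditionally on the σ-algebra `m`, a copula update
by a uniform variable `V` has a sub-Gaussian moment generating function. -/
theorem lintegral_mul_exp_Hcop_sub_le {Ω : Type*} {m : MeasurableSpace Ω} [mΩ : MeasurableSpace Ω]
    (hm : m ≤ mΩ) (P : Measure Ω) [IsProbabilityMeasure P] {ρ : ℝ}
    (hρ : ρ ∈ Set.Ioo (-1 : ℝ) 1) {U V : Ω → ℝ} (hU : Measurable[m] U)
    (hU01 : ∀ ω, U ω ∈ Set.Ioo (0 : ℝ) 1) (hV : Measurable V)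
    (hV01 : ∀ ω, V ω ∈ Set.Ioo (0 : ℝ) 1)
    (hunif : ∀ A : Set Ω, MeasurableSet[m] A → ∀ u ∈ Set.Icc (0 : ℝ) 1,
      P (A ∩ {ω | V ω ≤ u}) = P A * ENNReal.ofReal u)
    {W : Ω → ENNReal} (hW : Measurable[m] W) (c : ℝ) :
    ∫⁻ ω, W ω * ENNReal.ofReal (Real.exp (c * (Hcop ρ (U ω) (V ω) - U ω))) ∂P
      ≤ ENNReal.ofReal (Real.exp (c ^ 2 / 8)) * ∫⁻ ω, W ω ∂P := by
  have hX : Measurable[m] fun ω => (W ω, U ω) := hW.prodMk hU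
  have hX' : Measurable fun ω => (W ω, U ω) := hX.mono hm le_rfl
  have hprod : P.map (fun ω => ((W ω, U ω), V ω))
      = (P.map fun ω => (W ω, U ω)).prod ((gaussianReal 0 1).map Phi) := by
    have : IsProbabilityMeasure (P.map fun ω => (W ω, U ω)) :=
      Measure.isProbabilityMeasure_map hX'.aemeasurable
    symm
    refine Measure.prod_eq fun s t hs ht => ?_
    have h := congrArg (fun μ => μ t) (map_restrict_eq_smul_map_Phi P hV hV01 (hunif _ (hX hs)))
    simp only [Measure.map_apply hV ht, Measure.restrict_apply (hV ht), Measure.smul_apply,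
      smul_eq_mul] at h
    rw [Measure.map_apply (hX'.prodMk hV) (hs.prod ht), Measure.map_apply hX' hs, ← h,
      Set.mk_preimage_prod, Set.inter_comm]
  have hf : Measurable fun p : (ENNReal × ℝ) × ℝ =>
      p.1.1 * ENNReal.ofReal (Real.exp (c * (Hcop ρ p.1.2 p.2 - p.1.2))) := by
    have h1 : Measurable fun p : (ENNReal × ℝ) × ℝ => Hcop ρ p.1.2 p.2 :=
      (measurable_Hcop ρ).comp (by fun_prop : Measurable fun p : (ENNReal × ℝ) × ℝ => (p.1.2, p.2))
    fun_prop
  calc ∫⁻ ω, W ω * ENNReal.ofReal (Real.exp (c * (Hcop ρ (U ω) (V ω) - U ω))) ∂P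
      = ∫⁻ p, p.1.1 * ENNReal.ofReal (Real.exp (c * (Hcop ρ p.1.2 p.2 - p.1.2)))
          ∂(P.map fun ω => ((W ω, U ω), V ω)) := (lintegral_map hf (hX'.prodMk hV)).symm
    _ = ∫⁻ ω, ∫⁻ v, W ω * ENNReal.ofReal (Real.exp (c * (Hcop ρ (U ω) v - U ω)))
          ∂((gaussianReal 0 1).map Phi) ∂P := by
      rw [hprod, lintegral_prod _ hf.aemeasurable, lintegral_map hf.lintegral_prod_right' hX']
    _ ≤ ∫⁻ ω, W ω * ENNReal.ofReal (Real.exp (c ^ 2 / 8)) ∂P := by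
      refine lintegral_mono fun ω => ?_
      have h1 : Measurable fun v => Hcop ρ (U ω) v :=
        (measurable_Hcop ρ).comp measurable_prodMk_left
      rw [lintegral_const_mul _ (by fun_prop)]
      gcongr
      exact lintegral_exp_Hcop_sub_le hρ (hU01 ω) c
    _ = _ := by rw [lintegral_mul_const _ (hW.mono hm le_rfl), mul_comm]

theorem measurable_uncurry_copula_step {Ω : Type*} [MeasurableSpace Ω] (ρ a : ℝ) {F : Ω → ℝ → ℝ}
    (hF : Measurable (Function.uncurry F)) {y : Ω → ℝ} (hy : Measurable y) :
    Measurable fun p : Ω × ℝ =>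
      (1 - a) * F p.1 p.2 + a * Hcop ρ (F p.1 p.2) (F p.1 (y p.1)) := by
  have h1 : Measurable fun p : Ω × ℝ => F p.1 p.2 := hF
  have h2 : Measurable fun p : Ω × ℝ => F p.1 (y p.1) :=
    hF.comp (measurable_fst.prodMk (hy.comp measurable_fst))
  exact (h1.const_mul _).add (((measurable_Hcop ρ).comp (h1.prodMk h2)).const_mul _)

theorem measurable_uncurry_of_continuous_right {Ω : Type*} [MeasurableSpace Ω] {F : Ω → ℝ → ℝ}
    (hcont : ∀ ω, Continuous (F ω)) (hmeas : ∀ t, Measurable fun ω => F ω t) :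
    Measurable (Function.uncurry F) :=
  (measurable_uncurry_of_continuous_of_measurable (u := fun t ω => F ω t) hcont hmeas).comp
    measurable_swap

namespace CopulaProcess

variable {Ω : Type*} [mΩ : MeasurableSpace Ω] {P : Measure Ω}

theorem Pk_mem_Ioo (Q : CopulaProcess Ω P) (k : ℕ) (ω : Ω) (t : ℝ) :
    Q.Pk k ω t ∈ Set.Ioo (0 : ℝ) 1 := by
  induction k generalizing t with
  | zero => exact Q.mem0 ω t
  | succ k ih =>
    rw [Q.step (k + 1) (by omega), Nat.add_sub_cancel]
    obtain ⟨ha0, ha1⟩ := Q.hα (k + 1) (by omega)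
    obtain ⟨hp0, hp1⟩ := ih t
    obtain ⟨hh0, hh1⟩ := Hcop_mem_Icc Q.ρ (Q.Pk k ω t) (Q.Pk k ω (Q.y (k + 1) ω))
    constructor
    · nlinarith [mul_pos (sub_pos.2 ha1) hp0, mul_nonneg ha0.le hh0]
    · nlinarith [mul_pos (sub_pos.2 ha1) (sub_pos.2 hp1), mul_nonneg ha0.le (sub_nonneg.2 hh1)]

theorem measurable_uncurry_Pk (Q : CopulaProcess Ω P) (k : ℕ) :
    Measurable[(Q.ℱ k).prod inferInstance] (Function.uncurry (Q.Pk k)) := by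
  induction k with
  | zero =>
    exact @measurable_uncurry_of_continuous_right Ω (Q.ℱ 0) _ Q.cont0
      fun t => (Q.meas0 t).measurable
  | succ k ih =>
    have hF : Measurable[(Q.ℱ (k + 1)).prod inferInstance] (Function.uncurry (Q.Pk k)) :=
      ih.mono (sup_le_sup_right (MeasurableSpace.comap_mono (Q.ℱ.mono (Nat.le_succ k))) _) le_rfl
    have h := @measurable_uncurry_copula_step Ω (Q.ℱ (k + 1)) Q.ρ (Q.α (Q.n + (k + 1))) _ hF _
      (Q.measy (k + 1) (by omega)).measurable
    have he : Function.uncurry (Q.Pk (k + 1)) = fun p : Ω × ℝ =>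
        (1 - Q.α (Q.n + (k + 1))) * Q.Pk k p.1 p.2
          + Q.α (Q.n + (k + 1)) * Hcop Q.ρ (Q.Pk k p.1 p.2) (Q.Pk k p.1 (Q.y (k + 1) p.1)) := by
      ext p
      exact Q.step (k + 1) (by omega) p.1 p.2
    rw [he]
    exact h

theorem measurable_Pk (Q : CopulaProcess Ω P) (k : ℕ) (t : ℝ) :
    Measurable[Q.ℱ k] fun ω => Q.Pk k ω t :=
  (Q.measurable_uncurry_Pk k).comp (@measurable_prodMk_right Ω ℝ (Q.ℱ k) _ t)

theorem measurable_pit (Q : CopulaProcess Ω P) (k : ℕ) :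
    Measurable fun ω => Q.Pk k ω (Q.y (k + 1) ω) := by
  have h : Measurable (Function.uncurry (Q.Pk k)) :=
    (Q.measurable_uncurry_Pk k).mono
      (sup_le_sup_right (MeasurableSpace.comap_mono (Q.ℱ.le k)) _) le_rfl
  exact h.comp (measurable_id.prodMk
    ((Q.measy (k + 1) (by omega)).measurable.mono (Q.ℱ.le _) le_rfl))

/-- **Azuma-Hoeffding** in exponential form for the increments of the copula process. -/
theorem lintegral_exp_Pk_sub_le [IsProbabilityMeasure P] (Q : CopulaProcess Ω P) (t c : ℝ)
    (N K : ℕ) :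
    ∫⁻ ω, ENNReal.ofReal (Real.exp (c * (Q.Pk (N + K) ω t - Q.Pk N ω t))) ∂P
      ≤ ENNReal.ofReal
          (Real.exp (c ^ 2 * (∑ k ∈ Finset.range K, Q.α (Q.n + (N + k + 1)) ^ 2) / 8)) := by
  induction K with
  | zero => simp
  | succ K ih =>
    have hstep : ∀ ω,
        ENNReal.ofReal (Real.exp (c * (Q.Pk (N + (K + 1)) ω t - Q.Pk N ω t)))
          = ENNReal.ofReal (Real.exp (c * (Q.Pk (N + K) ω t - Q.Pk N ω t)))
            * ENNReal.ofReal (Real.exp (c * Q.α (Q.n + (N + K + 1)) *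
              (Hcop Q.ρ (Q.Pk (N + K) ω t) (Q.Pk (N + K) ω (Q.y (N + K + 1) ω))
                - Q.Pk (N + K) ω t))) := fun ω => by
      rw [← ENNReal.ofReal_mul (Real.exp_pos _).le, ← Real.exp_add, ← add_assoc,
        Q.step (N + K + 1) (by omega), Nat.add_sub_cancel]
      congr 2
      ring
    have hN : Measurable[Q.ℱ (N + K)] fun ω => Q.Pk N ω t :=
      (Q.measurable_Pk N t).mono (Q.ℱ.mono (Nat.le_add_right N K)) le_rfl
    have hW : Measurable[Q.ℱ (N + K)] fun ω =>
        ENNReal.ofReal (Real.exp (c * (Q.Pk (N + K) ω t - Q.Pk N ω t))) :=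
      (((Q.measurable_Pk (N + K) t).sub hN).const_mul c).exp.ennreal_ofReal
    simp_rw [hstep]
    refine (lintegral_mul_exp_Hcop_sub_le (Q.ℱ.le (N + K)) P Q.hρ (Q.measurable_Pk (N + K) t)
      (fun ω => Q.Pk_mem_Ioo _ ω t) (Q.measurable_pit (N + K)) (fun ω => Q.Pk_mem_Ioo _ ω _)
      (fun A hA => Q.unif (N + K + 1) (by omega) A hA) hW _).trans ?_
    refine (mul_le_mul_right ih _).trans_eq ?_
    rw [← ENNReal.ofReal_mul (Real.exp_pos _).le, ← Real.exp_add, Finset.sum_range_succ]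
    congr 2
    ring

theorem lintegral_exp_limit_sub_le [IsProbabilityMeasure P] (Q : CopulaProcess Ω P) {t : ℝ}
    {L : Ω → ℝ} (hL : ∀ᵐ ω ∂P, Tendsto (fun M => Q.Pk M ω t) atTop (𝓝 (L ω))) (N : ℕ) {B : ℝ}
    (hB : ∀ K, ∑ k ∈ Finset.range K, Q.α (Q.n + (N + k + 1)) ^ 2 ≤ B) (c : ℝ) :
    ∫⁻ ω, ENNReal.ofReal (Real.exp (c * (L ω - Q.Pk N ω t))) ∂P
      ≤ ENNReal.ofReal (Real.exp (c ^ 2 * B / 8)) := by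
  have hmeas : ∀ M, Measurable fun ω => Q.Pk M ω t := fun M =>
    (Q.measurable_Pk M t).mono (Q.ℱ.le M) le_rfl
  have hlim : ∀ᵐ ω ∂P, ENNReal.ofReal (Real.exp (c * (L ω - Q.Pk N ω t)))
      = liminf (fun K => ENNReal.ofReal (Real.exp (c * (Q.Pk (N + K) ω t - Q.Pk N ω t)))) atTop := by
    filter_upwards [hL] with ω hω
    have h : Tendsto (fun K => Q.Pk (N + K) ω t) atTop (𝓝 (L ω)) := by
      simpa only [add_comm N] using (tendsto_add_atTop_iff_nat N).2 hω
    exact (ENNReal.tendsto_ofReal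
      ((Real.continuous_exp.tendsto _).comp ((h.sub_const _).const_mul c))).liminf_eq.symm
  rw [lintegral_congr_ae hlim]
  refine (lintegral_liminf_le fun K =>
    (((hmeas (N + K)).sub (hmeas N)).const_mul c).exp.ennreal_ofReal).trans ?_
  refine liminf_le_of_le (h := fun b hb => ?_)
  obtain ⟨K, hK⟩ := hb.exists
  refine hK.trans ((Q.lintegral_exp_Pk_sub_le t c N K).trans ?_)
  gcongr
  exact hB K

end CopulaProcess

/-- Chernoff bound: a sub-Gaussian exponential moment at `c` controls the tail of `c * X`. -/
theorem measure_lt_mul_le_of_lintegral_exp_le {Ω : Type*} [MeasurableSpace Ω] {P : Measure Ω}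
    {X : Ω → ℝ} (hX : AEMeasurable X P) {c a b : ℝ}
    (h : ∫⁻ ω, ENNReal.ofReal (Real.exp (c * X ω)) ∂P ≤ ENNReal.ofReal (Real.exp b)) :
    P {ω | a < c * X ω} ≤ ENNReal.ofReal (Real.exp (b - a)) := by
  have hmarkov := mul_meas_ge_le_lintegral₀ (μ := P)
    (hX.const_mul c).exp.ennreal_ofReal (ENNReal.ofReal (Real.exp a))
  have hsub : P {ω | a < c * X ω} ≤ P {ω | ENNReal.ofReal (Real.exp a)
      ≤ ENNReal.ofReal (Real.exp (c * X ω))} := by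
    refine measure_mono fun ω hω => ?_
    exact ENNReal.ofReal_le_ofReal (Real.exp_le_exp.2 (le_of_lt hω))
  have h1 : ENNReal.ofReal (Real.exp a) * P {ω | a < c * X ω} ≤ ENNReal.ofReal (Real.exp b) :=
    (mul_le_mul_right hsub _).trans (hmarkov.trans h)
  rw [Real.exp_sub, ENNReal.ofReal_div_of_pos (Real.exp_pos a)]
  rw [ENNReal.le_div_iff_mul_le (Or.inl (by simp [Real.exp_pos])) (Or.inl ENNReal.ofReal_ne_top),
    mul_comm]
  exact h1

/-- Comparison of `x ^ (-(s + 1))` with the increment of the primitive of `z ↦ z ^ (-(s + 1))`. -/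
theorem rpow_neg_le_sub_rpow_div {s x : ℝ} (hs : 0 < s) (hx : 1 < x) :
    x ^ (-(s + 1)) ≤ ((x - 1) ^ (-s) - x ^ (-s)) / s := by
  have hx0 : 0 < x := by linarith
  have h1 : (x - 1) = x * (1 - x⁻¹) := by field_simp
  have hpos : 0 < 1 - x⁻¹ := by
    have := inv_lt_one_of_one_lt₀ hx
    linarith
  have h2 : 1 + s * x⁻¹ ≤ (1 - x⁻¹) ^ (-s) := by
    rw [Real.rpow_def_of_pos hpos]
    have := Real.log_le_sub_one_of_pos hpos
    nlinarith [Real.add_one_le_exp (Real.log (1 - x⁻¹) * -s)]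
  rw [le_div_iff₀ hs, h1, Real.mul_rpow hx0.le hpos.le, neg_add, Real.rpow_add hx0,
    Real.rpow_neg_one]
  nlinarith [mul_le_mul_of_nonneg_left h2 (Real.rpow_pos_of_pos hx0 (-s)).le]

theorem sum_rpow_neg_le {s x : ℝ} (hs : 0 < s) (hx : 0 < x) (K : ℕ) :
    ∑ k ∈ Finset.range K, (x + k + 1) ^ (-(s + 1)) ≤ (x ^ (-s) - (x + K) ^ (-s)) / s := by
  induction K with
  | zero => simp
  | succ K ih =>
    have h := rpow_neg_le_sub_rpow_div (x := x + K + 1) hs (lt_add_of_pos_left _ (by positivity))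
    rw [add_sub_cancel_right] at h
    rw [Finset.sum_range_succ]
    push_cast
    rw [← add_assoc]
    calc _ ≤ _ := add_le_add ih h
      _ = _ := by ring

/-- (Proposition 3) In the copula-update process with learning rates
`α_{n+k} = C·(n+k+1)^{−β}` for `C > 0` and `β ∈ (1/2, 1]`, if `P_∞(y)` denotes the
almost-sure limit of `P_M(y)`, then for every `y ∈ ℝ`, `N ≥ 0`, and `δ ∈ (0,1)`, with
probability at least `1 − δ`,
`|P_∞(y) − P_N(y)| ≤ √(C²·log(2/δ)/(2β − 1))·(n + N)^{1/2 − β}`. -/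
theorem copulaProcess_posterior_contraction {Ω : Type*} [mΩ : MeasurableSpace Ω]
    (P : Measure Ω) [IsProbabilityMeasure P] (Q : CopulaProcess Ω P)
    (C β : ℝ) (hC : 0 < C) (hβ : β ∈ Set.Ioc (1 / 2 : ℝ) 1)
    (hrate : ∀ k, 1 ≤ k → Q.α (Q.n + k) = C * ((Q.n : ℝ) + k + 1) ^ (-β))
    (Pinf : ℝ → Ω → ℝ)
    (hPinf : ∀ t : ℝ, ∀ᵐ ω ∂P, Tendsto (fun M => Q.Pk M ω t) atTop (𝓝 (Pinf t ω)))
    (t : ℝ) (N : ℕ) (δ : ℝ) (hδ : δ ∈ Set.Ioo (0 : ℝ) 1) :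
    ENNReal.ofReal (1 - δ) ≤
      P {ω | |Pinf t ω - Q.Pk N ω t| ≤
        Real.sqrt (C ^ 2 * Real.log (2 / δ) / (2 * β - 1)) *
          ((Q.n : ℝ) + N) ^ (1 / 2 - β)} := by
  obtain ⟨hδ0, hδ1⟩ := hδ
  have hs : 0 < 2 * β - 1 := by linarith [hβ.1]
  set s := 2 * β - 1 with hsdef
  have hx : 0 < (Q.n : ℝ) + N := by
    have : (1 : ℝ) ≤ Q.n := by exact_mod_cast Q.hn
    positivity
  set x := (Q.n : ℝ) + N with hxdef
  have hlog : 0 < Real.log (2 / δ) := Real.log_pos (by rw [lt_div_iff₀ hδ0]; linarith)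
  set ℓ := Real.log (2 / δ) with hℓ
  set B := C ^ 2 * (x ^ (-s) / s) with hBdef
  have hBpos : 0 < B := by positivity
  have hB : ∀ K, ∑ k ∈ Finset.range K, Q.α (Q.n + (N + k + 1)) ^ 2 ≤ B := fun K => by
    have hterm : ∀ k ∈ Finset.range K,
        Q.α (Q.n + (N + k + 1)) ^ 2 = C ^ 2 * (x + 1 + k + 1) ^ (-(s + 1)) := fun k _ => by
      rw [hrate (N + k + 1) (by omega), mul_pow, ← Real.rpow_natCast (_ ^ (-β)),
        ← Real.rpow_mul (by positivity)]
      congr 2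
      · push_cast
        ring
      · push_cast
        ring
    rw [Finset.sum_congr rfl hterm, ← Finset.mul_sum]
    refine mul_le_mul_of_nonneg_left ((sum_rpow_neg_le hs (by positivity) K).trans ?_)
      (sq_nonneg C)
    refine div_le_div_of_nonneg_right ?_ hs.le
    have h1 : (x + 1) ^ (-s) ≤ x ^ (-s) :=
      Real.rpow_le_rpow_of_nonpos hx (by linarith) (by linarith)
    have h2 : 0 ≤ (x + 1 + K) ^ (-s) := by positivity
    linarith
  set ε := Real.sqrt (C ^ 2 * ℓ / s) * x ^ (1 / 2 - β) with hε
  have hεpos : 0 < ε := by positivity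
  have hεsq : ε ^ 2 = B * ℓ := by
    rw [hε, mul_pow, Real.sq_sqrt (by positivity), ← Real.rpow_natCast (x ^ _),
      ← Real.rpow_mul hx.le, hBdef]
    have : (1 / 2 - β) * ((2 : ℕ) : ℝ) = -s := by
      push_cast
      ring
    rw [this]
    ring
  have htail : ∀ c : ℝ, c ^ 2 = (2 * ε / B) ^ 2 →
      P {ω | 2 * ℓ < c * (Pinf t ω - Q.Pk N ω t)} ≤ ENNReal.ofReal (δ / 2) := fun c hc => by
    have hmeas : ∀ M, Measurable fun ω => Q.Pk M ω t := fun M =>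
      (Q.measurable_Pk M t).mono (Q.ℱ.le M) le_rfl
    have hX : AEMeasurable (fun ω => Pinf t ω - Q.Pk N ω t) P :=
      (aemeasurable_of_tendsto_metrizable_ae atTop (fun M => (hmeas M).aemeasurable)
        (hPinf t)).sub (hmeas N).aemeasurable
    refine (measure_lt_mul_le_of_lintegral_exp_le hX
      (Q.lintegral_exp_limit_sub_le (hPinf t) N hB c)).trans (ENNReal.ofReal_le_ofReal ?_)
    have hcB : c ^ 2 * B / 8 = ℓ / 2 := by
      rw [hc, div_pow, mul_pow, hεsq]
      field_simp
      norm_num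
    have hexp : δ / 2 = Real.exp (-ℓ) := by
      rw [Real.exp_neg, hℓ, Real.exp_log (by positivity), inv_div]
    rw [hcB, hexp]
    exact Real.exp_le_exp.2 (by linarith)
  have hcompl : P {ω | |Pinf t ω - Q.Pk N ω t| ≤ ε}ᶜ ≤ ENNReal.ofReal δ := by
    have hsub : {ω | |Pinf t ω - Q.Pk N ω t| ≤ ε}ᶜ
        ⊆ {ω | 2 * ℓ < 2 * ε / B * (Pinf t ω - Q.Pk N ω t)}
          ∪ {ω | 2 * ℓ < -(2 * ε / B) * (Pinf t ω - Q.Pk N ω t)} := by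
      intro ω hω
      have hω' : ε < |Pinf t ω - Q.Pk N ω t| := not_le.1 hω
      have h2 : 2 * ε / B * ε = 2 * ℓ := by
        rw [div_mul_eq_mul_div, mul_assoc, ← sq, hεsq]
        field_simp
      have hc : 0 < 2 * ε / B := by positivity
      rcases lt_abs.1 hω' with h | h
      · exact Or.inl (h2 ▸ mul_lt_mul_of_pos_left h hc)
      · refine Or.inr ?_
        rw [Set.mem_ofPred_eq, neg_mul, ← mul_neg, ← h2]
        exact mul_lt_mul_of_pos_left h hc
    refine (measure_mono hsub).trans ((measure_union_le _ _).trans ?_)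
    refine (add_le_add (htail _ rfl) (htail _ (neg_sq _))).trans_eq ?_
    rw [← ENNReal.ofReal_add (by positivity) (by positivity), add_halves]
  have hone : (1 : ENNReal) ≤ P {ω | |Pinf t ω - Q.Pk N ω t| ≤ ε} + ENNReal.ofReal δ := by
    refine le_trans ?_ (add_le_add_right hcompl _)
    rw [← measure_univ (μ := P), ← Set.union_compl_self {ω | |Pinf t ω - Q.Pk N ω t| ≤ ε}]
    exact measure_union_le _ _
  rw [ENNReal.ofReal_sub _ hδ0.le, ENNReal.ofReal_one]
  exact tsub_le_iff_right.2 hone
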